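/- Suppose the data satisfy Y_i = f(X_i) for a strictly decreasing function f, with the X_i pairwise distinct. Then for any M ∈ [n] the revised Chatterjee rank correlation equals exactly ξ_{n,M} = 1 - 3(M+1)·[(5n+1)/4 - (2M+1)/3] / ((n+1)(n + (M+1)/4)). -/

import Mathlib

open Finset

noncomputable section

/-- The rank of `Y_i` among `Y_1,…,Y_n`. -/
def rankOf {n : ℕ} (y : Fin n → ℝ) (i : Fin n) : ℕ :=
  (Finset.univ.filter fun j => y j ≤ y i).card

/-- The index of the `m`-th right nearest neighbor of `X_i` (the index `j` such that exactly
`m` sample points `X_k` satisfy `X_i < X_k ≤ X_j`); equals `i` if no such index exists. -/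
def rightNN {n : ℕ} (x : Fin n → ℝ) (m : ℕ) (i : Fin n) : Fin n :=
  if h : ∃ j, (Finset.univ.filter fun k => x i < x k ∧ x k ≤ x j).card = m then h.choose else i

/-- The revised Chatterjee rank correlation `ξ_{n,M}`. -/
def xiStat (n M : ℕ) (x y : Fin n → ℝ) : ℝ :=
  -2 + 6 * (∑ i, ∑ m ∈ Finset.Icc 1 M,
      (min (rankOf y i) (rankOf y (rightNN x m i)) : ℝ)) /
    ((n + 1) * (n * M + M * (M + 1) / 4))

theorem rankOf_pos {n : ℕ} (y : Fin n → ℝ) (i : Fin n) : 1 ≤ rankOf y i :=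
  Finset.card_pos.mpr ⟨i, by simp⟩

theorem rankOf_le {n : ℕ} (y : Fin n → ℝ) (i : Fin n) : rankOf y i ≤ n := by
  simpa [rankOf] using Finset.card_filter_le (Finset.univ : Finset (Fin n)) fun j => y j ≤ y i

/-- The larger rank is the smaller rank plus the number of values strictly above the smaller. -/
theorem rankOf_add_card {n : ℕ} (y : Fin n → ℝ) {i j : Fin n} (h : y j ≤ y i) :
    rankOf y j + (Finset.univ.filter fun k => y j < y k ∧ y k ≤ y i).card = rankOf y i := by
  unfold rankOf
  rw [← Finset.card_union_of_disjoint]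
  · congr 1
    ext k
    simp only [Finset.mem_union, Finset.mem_filter, Finset.mem_univ, true_and]
    constructor
    · rintro (hk | hk)
      exacts [hk.trans h, hk.2]
    · intro hk
      exact (le_or_gt (y k) (y j)).imp id fun hlt => ⟨hlt, hk⟩
  · rw [Finset.disjoint_filter]
    exact fun k _ hk hk' => hk.not_gt hk'.1

theorem rankOf_lt {n : ℕ} (y : Fin n → ℝ) {i j : Fin n} (h : y j < y i) :
    rankOf y j < rankOf y i := by
  have hpos : 0 < (Finset.univ.filter fun k => y j < y k ∧ y k ≤ y i).card :=
    Finset.card_pos.mpr ⟨i, by simp [h]⟩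
  have := rankOf_add_card y h.le
  omega

theorem rankOf_injective {n : ℕ} {y : Fin n → ℝ} (hy : Function.Injective y) :
    Function.Injective (rankOf y) := by
  intro i j hij
  by_contra hne
  rcases lt_or_gt_of_ne (hy.ne hne) with h | h
  · exact (rankOf_lt y h).ne hij
  · exact (rankOf_lt y h).ne' hij

theorem image_rankOf {n : ℕ} {y : Fin n → ℝ} (hy : Function.Injective y) :
    Finset.univ.image (rankOf y) = Finset.Icc 1 n := by
  apply Finset.eq_of_subset_of_card_le
  · intro r hr
    obtain ⟨i, -, rfl⟩ := Finset.mem_image.mp hr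
    exact Finset.mem_Icc.mpr ⟨rankOf_pos y i, rankOf_le y i⟩
  · rw [Finset.card_image_of_injective _ (rankOf_injective hy)]
    simp

/-- For strictly decreasing data, the points in `(X_i, X_j]` number the difference of the ranks. -/
theorem rankOf_add_card_of_strictAnti {n : ℕ} {x : Fin n → ℝ} (hx : Function.Injective x)
    {f : ℝ → ℝ} (hf : StrictAnti f) {i j : Fin n} (h : x i < x j) :
    rankOf (fun i => f (x i)) j + (Finset.univ.filter fun k => x i < x k ∧ x k ≤ x j).card
      = rankOf (fun i => f (x i)) i := by
  rw [← rankOf_add_card (fun i => f (x i)) (hf h).le]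
  congr 1
  simp only [hf.lt_iff_gt, hf.le_iff_ge]
  refine Finset.card_bij' (fun k _ => if k = j then i else k) (fun k _ => if k = i then j else k)
    ?_ ?_ ?_ ?_ <;>
  · intro k hk
    have h₁ : x k = x i → k = i := fun e => hx e
    have h₂ : x k = x j → k = j := fun e => hx e
    simp only [Finset.mem_filter, Finset.mem_univ, true_and] at hk ⊢
    grind

theorem min_rankOf_rightNN {n : ℕ} {x : Fin n → ℝ} (hx : Function.Injective x)
    {f : ℝ → ℝ} (hf : StrictAnti f) {m : ℕ} (hm : 1 ≤ m) (i : Fin n) :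
    min (rankOf (fun i => f (x i)) i) (rankOf (fun i => f (x i)) (rightNN x m i))
      = if m < rankOf (fun i => f (x i)) i then rankOf (fun i => f (x i)) i - m
        else rankOf (fun i => f (x i)) i := by
  have key : ∀ j, (Finset.univ.filter fun k => x i < x k ∧ x k ≤ x j).card = m →
      rankOf (fun i => f (x i)) j + m = rankOf (fun i => f (x i)) i := by
    intro j hj
    obtain ⟨k, hk⟩ := Finset.card_pos.mp (hj ▸ hm :
      0 < (Finset.univ.filter fun k => x i < x k ∧ x k ≤ x j).card)
    simp only [Finset.mem_filter, Finset.mem_univ, true_and] at hk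
    rw [← hj]
    exact rankOf_add_card_of_strictAnti hx hf (hk.1.trans_le hk.2)
  unfold rightNN
  split_ifs with h hlt hlt
  · have := key _ h.choose_spec
    omega
  · have := key _ h.choose_spec
    have := rankOf_pos (fun i => f (x i)) h.choose
    omega
  · refine absurd ?_ h
    have hmem : rankOf (fun i => f (x i)) i - m ∈
        Finset.univ.image (rankOf fun i => f (x i)) := by
      have hinj : Function.Injective fun i => f (x i) := hf.injective.comp hx
      rw [image_rankOf hinj, Finset.mem_Icc]
      have := rankOf_le (fun i => f (x i)) i
      omega
    obtain ⟨j, -, hj⟩ := Finset.mem_image.mp hmem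
    have hij : x i < x j := by
      by_contra! hle
      rcases hle.eq_or_lt with he | hl
      · rw [hx he] at hj
        omega
      · have := rankOf_lt (fun i => f (x i)) (hf hl)
        omega
    have := rankOf_add_card_of_strictAnti hx hf hij
    exact ⟨j, by omega⟩
  · exact min_self _

theorem sum_Icc_cast (n : ℕ) : ∑ r ∈ Finset.Icc 1 n, (r : ℝ) = n * (n + 1) / 2 := by
  induction n with
  | zero => simp
  | succ n ih =>
    rw [Finset.sum_Icc_succ_top (by omega), ih]
    push_cast
    ring

theorem sum_Icc_ite_sub {m n : ℕ} (h : m ≤ n) :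
    ∑ r ∈ Finset.Icc 1 n, ((if m < r then r - m else r : ℕ) : ℝ)
      = (n - m) * (n - m + 1) / 2 + m * (m + 1) / 2 := by
  induction n, h using Nat.le_induction with
  | base =>
    rw [Finset.sum_congr rfl fun r hr => by
      rw [if_neg (not_lt.mpr (Finset.mem_Icc.mp hr).2)], sum_Icc_cast]
    ring
  | succ n h ih =>
    rw [Finset.sum_Icc_succ_top (by omega), ih, if_pos (by omega), Nat.cast_sub (by omega)]
    push_cast
    ring

theorem sum_Icc_triangular (n M : ℕ) :
    ∑ m ∈ Finset.Icc 1 M, (((n : ℝ) - m) * (n - m + 1) / 2 + m * (m + 1) / 2)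
      = M * n * (n + 1) / 2 - n * M * (M + 1) / 2 + M * (M + 1) * (2 * M + 1) / 6 := by
  induction M with
  | zero => simp
  | succ M ih =>
    rw [Finset.sum_Icc_succ_top (by omega), ih]
    push_cast
    ring

theorem sum_min_rankOf_rightNN {n M : ℕ} (hMn : M ≤ n) {x : Fin n → ℝ}
    (hx : Function.Injective x) {f : ℝ → ℝ} (hf : StrictAnti f) :
    ∑ i, ∑ m ∈ Finset.Icc 1 M, (min (rankOf (fun i => f (x i)) i)
        (rankOf (fun i => f (x i)) (rightNN x m i)) : ℝ)
      = M * n * (n + 1) / 2 - n * M * (M + 1) / 2 + M * (M + 1) * (2 * M + 1) / 6 := by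
  rw [Finset.sum_comm, ← sum_Icc_triangular]
  refine Finset.sum_congr rfl fun m hm => ?_
  obtain ⟨hm1, hmM⟩ := Finset.mem_Icc.mp hm
  have hinj : Function.Injective fun i => f (x i) := hf.injective.comp hx
  rw [← sum_Icc_ite_sub (hmM.trans hMn), ← image_rankOf hinj,
    Finset.sum_image (rankOf_injective hinj).injOn]
  refine Finset.sum_congr rfl fun i _ => ?_
  rw [← Nat.cast_min, min_rankOf_rightNN hx hf hm1]

/-- If `Y_i = f(X_i)` for a strictly decreasing `f` and the `X_i` are
pairwise distinct, then for any `M ∈ [n]`,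
`ξ_{n,M} = 1 - 3(M+1)·[(5n+1)/4 - (2M+1)/3] / ((n+1)(n + (M+1)/4))` exactly. -/
theorem xiStat_of_strictAnti (n M : ℕ) (hn : 1 ≤ n) (hM1 : 1 ≤ M) (hMn : M ≤ n)
    (x : Fin n → ℝ) (hx : Function.Injective x)
    (f : ℝ → ℝ) (hf : StrictAnti f) :
    xiStat n M x (fun i => f (x i))
      = 1 - 3 * (M + 1) * ((5 * (n : ℝ) + 1) / 4 - (2 * (M : ℝ) + 1) / 3)
          / (((n : ℝ) + 1) * ((n : ℝ) + (M + 1) / 4)) := by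
  unfold xiStat
  rw [sum_min_rankOf_rightNN hMn hx hf]
  have hM : (0 : ℝ) < M := by exact_mod_cast hM1
  have hn₀ : (0 : ℝ) < n := by exact_mod_cast hn
  have h₁ : (n : ℝ) + 1 ≠ 0 := by positivity
  have h₂ : (n : ℝ) + (M + 1) / 4 ≠ 0 := by positivity
  have h₃ : (n : ℝ) * M + M * (M + 1) / 4 = M * (n + (M + 1) / 4) := by ring
  rw [h₃]
  generalize hD : (n : ℝ) + (M + 1) / 4 = D at *
  field_simp
  subst hD
  ring
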